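/- In the scalar profiled-regret setting, if φ(ρ*/σ)·(k/(√(π/2)·σ))³ ≤ φ(0), then R̄(d_linear, γ) ≤ R̄(d_RT, γ) for all γ ∈ ℝ, with strict inequality for every γ ≠ 0. -/

import Mathlib

open MeasureTheory Set

noncomputable section

/-- The standard normal cumulative distribution function `Φ`. -/
def Phi (x : ℝ) : ℝ :=
  ∫ t in Set.Iic x, Real.exp (-(t ^ 2) / 2) / Real.sqrt (2 * Real.pi)

/-- The standard normal probability density function `φ`. -/
def phi (x : ℝ) : ℝ := Real.exp (-(x ^ 2) / 2) / Real.sqrt (2 * Real.pi)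

/-- The piecewise linear rule `d_linear` with randomization window `(−ρ, ρ)`. -/
def dlin (ρ x : ℝ) : ℝ :=
  if x < -ρ then 0 else if x ≤ ρ then (x + ρ) / (2 * ρ) else 1

/-- `E_γ[d]`: the expectation of the rule `d` under `N(γ, σ²)`. -/
def Eg (σ γ : ℝ) (d : ℝ → ℝ) : ℝ :=
  ∫ z, d z ∂ ProbabilityTheory.gaussianReal γ (Real.toNNReal (σ ^ 2))

/-- The profiled regret `R̄(d, γ) = sup_{u ∈ [γ−k, γ+k]} u·(𝟙{u ≥ 0} − E_γ[d])`. -/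
def Rbar (σ k : ℝ) (d : ℝ → ℝ) (γ : ℝ) : ℝ :=
  sSup ((fun u : ℝ => u * ((if 0 ≤ u then (1 : ℝ) else 0) - Eg σ γ d)) ''
    Set.Icc (γ - k) (γ + k))

/-- The Gaussian smoothing rule `d_RT(y) = Φ(y/√(2k²/π − σ²))`. -/
def dRT (σ k y : ℝ) : ℝ := Phi (y / Real.sqrt (2 * k ^ 2 / Real.pi - σ ^ 2))

open ProbabilityTheory Filter Topology

lemma phi_eq_pdf (x : ℝ) : phi x = gaussianPDFReal 0 1 x := by
  simp [phi, gaussianPDFReal, div_eq_inv_mul]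

lemma phi_pos (x : ℝ) : 0 < phi x := by
  unfold phi; positivity

lemma phi_cont : Continuous phi := by
  unfold phi; fun_prop

lemma phi_integrable : Integrable phi := by
  have : phi = gaussianPDFReal 0 1 := funext phi_eq_pdf
  rw [this]; exact integrable_gaussianPDFReal 0 1

lemma Phi_eq_real (x : ℝ) : Phi x = (gaussianReal 0 1).real (Iic x) := by
  rw [measureReal_def, gaussianReal_apply_eq_integral 0 one_ne_zero, ENNReal.toReal_ofReal]
  · unfold Phi
    refine integral_congr_ae (Eventually.of_forall fun t => ?_)
    exact phi_eq_pdf t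
  · exact integral_nonneg fun t => gaussianPDFReal_nonneg _ _ _

lemma Phi_eq_cdf (x : ℝ) : Phi x = cdf (gaussianReal 0 1) x := by
  rw [Phi_eq_real, cdf_eq_real]

lemma Phi_nonneg (x : ℝ) : 0 ≤ Phi x := by rw [Phi_eq_cdf]; exact cdf_nonneg _ _
lemma Phi_le_one (x : ℝ) : Phi x ≤ 1 := by rw [Phi_eq_cdf]; exact cdf_le_one _ _
lemma Phi_mono : Monotone Phi := fun x y h => by
  rw [Phi_eq_cdf, Phi_eq_cdf]; exact monotone_cdf _ h
lemma Phi_tendsto : Tendsto Phi atTop (𝓝 1) := by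
  have : Phi = cdf (gaussianReal 0 1) := funext Phi_eq_cdf
  rw [this]; exact tendsto_cdf_atTop _

lemma Phi_hasDerivAt (x : ℝ) : HasDerivAt Phi (phi x) x := by
  have h : Phi = fun y => Phi 0 + ∫ t in (0:ℝ)..y, phi t := by
    funext y
    have := intervalIntegral.integral_Iic_sub_Iic (f := phi) (a := 0) (b := y) (μ := volume)
      phi_integrable.integrableOn phi_integrable.integrableOn
    rw [← this]
    unfold Phi phi
    ring
  rw [h]
  exact (intervalIntegral.integral_hasDerivAt_right (phi_cont.intervalIntegrable _ _)
    (phi_cont.stronglyMeasurableAtFilter _ _) phi_cont.continuousAt).const_add _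

lemma Phi_cont : Continuous Phi :=
  continuous_iff_continuousAt.2 fun x => (Phi_hasDerivAt x).continuousAt

lemma gauss_Ici (σ γ t : ℝ) (hσ : 0 < σ) :
    (gaussianReal γ (Real.toNNReal (σ ^ 2))).real (Ici t) = Phi ((γ - t) / σ) := by
  have h1 : gaussianReal γ (Real.toNNReal (σ ^ 2))
      = (gaussianReal 0 1).map (fun z => γ - σ * z) := by
    have : (fun z : ℝ => γ - σ * z) = (fun z => γ - z) ∘ (fun z => σ * z) := rfl
    rw [this, ← Measure.map_map (by fun_prop) (by fun_prop), gaussianReal_map_const_mul,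
      gaussianReal_map_const_sub]
    congr 1
    · simp
    · rw [mul_one]
      ext
      simp [sq_nonneg]
  rw [h1, map_measureReal_apply (by fun_prop) measurableSet_Ici, Phi_eq_real]
  congr 1
  ext z
  simp only [mem_preimage, mem_Ici, mem_Iic]
  rw [le_div_iff₀ hσ]
  constructor <;> intro h <;> linarith

lemma Phi_neg (x : ℝ) : Phi (-x) = 1 - Phi x := by
  have h := gauss_Ici 1 0 x one_pos
  simp only [one_pow, zero_sub, div_one, Real.toNNReal_one] at h
  rw [← h, Phi_eq_real, ← compl_Iio, measureReal_compl measurableSet_Iio]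
  have : NullSingletonClass (gaussianReal 0 1) := nullSingletonClass_gaussianReal one_ne_zero
  simp [measureReal_def, measure_congr (Iio_ae_eq_Iic (μ := gaussianReal 0 1) (a := x))]

lemma Phi_zero : Phi 0 = 1 / 2 := by
  have := Phi_neg 0
  rw [neg_zero] at this
  linarith

lemma Eg_dRT (σ k γ : ℝ) (hσ : 0 < σ) (hk : Real.sqrt (Real.pi / 2) * σ < k) :
    Eg σ γ (dRT σ k) = Phi (γ / (k / Real.sqrt (Real.pi / 2))) := by
  have hq : 0 < Real.sqrt (Real.pi / 2) := Real.sqrt_pos.2 (by positivity)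
  have hq2 : Real.sqrt (Real.pi / 2) ^ 2 = Real.pi / 2 := Real.sq_sqrt (by positivity)
  set q := Real.sqrt (Real.pi / 2) with hqdef
  have hk0 : 0 < k := lt_trans (by positivity) hk
  have hpi : Real.pi = 2 * q ^ 2 := by linarith
  have hτ : 2 * k ^ 2 / Real.pi = (k / q) ^ 2 := by
    rw [hpi]; field_simp
  have hσk : σ < k / q := by rw [lt_div_iff₀ hq]; linarith
  have hs2 : 0 < (k / q) ^ 2 - σ ^ 2 := by nlinarith
  have hs := Real.sqrt_pos.2 hs2
  set s := Real.sqrt ((k / q) ^ 2 - σ ^ 2) with hsdef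
  have hss : s ^ 2 = (k / q) ^ 2 - σ ^ 2 := Real.sq_sqrt hs2.le
  have h1 : ∀ y, dRT σ k y = (gaussianReal 0 (Real.toNNReal (s ^ 2))).real (Ici (-y)) := by
    intro y
    rw [gauss_Ici s 0 (-y) hs, dRT, hτ, ← hsdef]
    congr 2; ring
  have h2 := gaussianReal_conv_gaussianReal (m₁ := γ) (m₂ := 0) (v₁ := Real.toNNReal (σ ^ 2))
    (v₂ := Real.toNNReal (s ^ 2))
  rw [add_zero, ← Real.toNNReal_add (by positivity) (by positivity), hss,
    add_sub_cancel] at h2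
  have h3 := gauss_Ici (k / q) γ 0 (by positivity)
  rw [sub_zero, ← h2, ← hss, ← integral_indicator_one measurableSet_Ici, integral_conv] at h3
  · rw [← h3, Eg]
    refine integral_congr_ae (Eventually.of_forall fun y => ?_)
    simp only
    rw [h1, ← integral_indicator_one measurableSet_Ici]
    refine integral_congr_ae (Eventually.of_forall fun z => ?_)
    simp only [indicator, mem_Ici, Pi.one_apply]
    congr 1
    apply propext
    constructor <;> intro h <;> linarith
  · exact (integrable_const (1 : ℝ)).indicator measurableSet_Ici

lemma dlin_eq (ρ y : ℝ) (hρ : 0 < ρ) :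
    dlin ρ y = (1 / (2 * ρ)) * ∫ t in Ioc (-ρ) ρ, (Iic y).indicator (1 : ℝ → ℝ) t := by
  rw [setIntegral_indicator measurableSet_Iic, Ioc_inter_Iic]
  simp only [Pi.one_apply, setIntegral_const, smul_eq_mul, mul_one, measureReal_def,
    Real.volume_Ioc]
  rw [ENNReal.toReal_ofReal', dlin]
  split_ifs with h1 h2
  · rw [max_eq_right]; · simp
    have := min_le_right ρ y
    linarith
  · rw [min_eq_right h2, max_eq_left (by linarith)]
    field_simp; ring
  · rw [min_eq_left (by linarith), max_eq_left (by linarith)]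
    field_simp; ring

lemma Eg_dlin (σ ρ γ : ℝ) (hσ : 0 < σ) (hρ : 0 < ρ) :
    Eg σ γ (dlin ρ) = (1 / (2 * ρ)) * ∫ u in (γ - ρ)..(γ + ρ), Phi (u / σ) := by
  have h1 : Eg σ γ (dlin ρ) = (1 / (2 * ρ)) * ∫ y, (∫ t in Ioc (-ρ) ρ,
      (Iic y).indicator (1 : ℝ → ℝ) t) ∂(gaussianReal γ (Real.toNNReal (σ ^ 2))) := by
    rw [Eg, ← integral_const_mul]
    exact integral_congr_ae (Eventually.of_forall fun y => dlin_eq ρ y hρ)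
  have hm : MeasurableSet {p : ℝ × ℝ | p.2 ≤ p.1} :=
    measurableSet_le measurable_snd measurable_fst
  rw [h1, integral_integral_swap]
  · have : ∀ t : ℝ, ∫ y, (Iic y).indicator (1 : ℝ → ℝ) t
        ∂(gaussianReal γ (Real.toNNReal (σ ^ 2))) = Phi ((γ - t) / σ) := by
      intro t
      rw [← gauss_Ici σ γ t hσ, ← integral_indicator_one measurableSet_Ici]
      rfl
    simp only [this]
    rw [← intervalIntegral.integral_of_le (by linarith),
      intervalIntegral.integral_comp_sub_left (fun u => Phi (u / σ)) γ]
    simp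
  · have : (Function.uncurry fun y t : ℝ => (Iic y).indicator (1 : ℝ → ℝ) t)
        = {p : ℝ × ℝ | p.2 ≤ p.1}.indicator (fun _ => (1 : ℝ)) := by
      ext ⟨y, t⟩; rfl
    rw [this]
    exact (integrable_const (1 : ℝ)).indicator hm

/-- closed form of the expectation of the linear rule -/
def Lf (σ ρ γ : ℝ) : ℝ := (1 / (2 * ρ)) * ∫ u in (γ - ρ)..(γ + ρ), Phi (u / σ)

lemma Phis_cont (σ : ℝ) : Continuous fun u => Phi (u / σ) := Phi_cont.comp (by fun_prop)

lemma Lf_hasDerivAt (σ ρ γ : ℝ) : HasDerivAt (Lf σ ρ)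
    ((1 / (2 * ρ)) * (Phi ((γ + ρ) / σ) - Phi ((γ - ρ) / σ))) γ := by
  have hc := Phis_cont σ
  have h : Lf σ ρ = fun γ => (1 / (2 * ρ)) *
      ((∫ u in (0 : ℝ)..(γ + ρ), Phi (u / σ)) - ∫ u in (0 : ℝ)..(γ - ρ), Phi (u / σ)) := by
    funext x
    rw [Lf, intervalIntegral.integral_interval_sub_left] <;> exact hc.intervalIntegrable _ _
  have hd : ∀ x, HasDerivAt (fun y => ∫ u in (0 : ℝ)..y, Phi (u / σ)) (Phi (x / σ)) x := fun x =>
    intervalIntegral.integral_hasDerivAt_right (hc.intervalIntegrable _ _)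
      (hc.stronglyMeasurableAtFilter _ _) hc.continuousAt
  rw [h]
  exact (((hd (γ + ρ)).comp_add_const γ ρ).sub ((hd (γ - ρ)).comp_sub_const γ ρ)).const_mul _

lemma Lf_neg (σ ρ γ : ℝ) (hρ : 0 < ρ) : Lf σ ρ (-γ) = 1 - Lf σ ρ γ := by
  have h := intervalIntegral.integral_comp_neg (a := γ - ρ) (b := γ + ρ) (fun u => Phi (u / σ))
  have h2 : ∀ u, Phi (-u / σ) = 1 - Phi (u / σ) := fun u => by rw [neg_div, Phi_neg]
  simp only [h2] at h
  rw [intervalIntegral.integral_sub (by simp) ((Phis_cont σ).intervalIntegrable _ _)] at h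
  simp only [intervalIntegral.integral_const, smul_eq_mul, mul_one] at h
  unfold Lf
  rw [show -γ - ρ = -(γ + ρ) by ring, show -γ + ρ = -(γ - ρ) by ring, ← h]
  field_simp; ring

lemma Lf_le_one (σ ρ γ : ℝ) (hρ : 0 < ρ) : Lf σ ρ γ ≤ 1 := by
  have h : ∫ u in (γ - ρ)..(γ + ρ), Phi (u / σ) ≤ ∫ u in (γ - ρ)..(γ + ρ), (1 : ℝ) :=
    intervalIntegral.integral_mono_on (by linarith) ((Phis_cont σ).intervalIntegrable _ _)
      (by simp) fun u _ => Phi_le_one _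
  simp only [intervalIntegral.integral_const, smul_eq_mul, mul_one] at h
  unfold Lf
  rw [one_div, inv_mul_le_iff₀ (by positivity)]
  linarith

lemma Lf_ge (σ ρ γ : ℝ) (hσ : 0 < σ) (hρ : 0 < ρ) : Phi ((γ - ρ) / σ) ≤ Lf σ ρ γ := by
  have h : ∫ u in (γ - ρ)..(γ + ρ), Phi ((γ - ρ) / σ) ≤ ∫ u in (γ - ρ)..(γ + ρ), Phi (u / σ) :=
    intervalIntegral.integral_mono_on (by linarith) (by simp)
      ((Phis_cont σ).intervalIntegrable _ _) fun u hu => Phi_mono (by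
        have := hu.1
        gcongr)
  simp only [intervalIntegral.integral_const, smul_eq_mul] at h
  unfold Lf
  rw [one_div, le_inv_mul_iff₀ (by positivity)]
  linarith

lemma Lf_tendsto (σ ρ : ℝ) (hσ : 0 < σ) (hρ : 0 < ρ) : Tendsto (Lf σ ρ) atTop (𝓝 1) := by
  refine tendsto_of_tendsto_of_tendsto_of_le_of_le (g := fun γ => Phi ((γ - ρ) / σ))
    (h := fun _ => 1) ?_ tendsto_const_nhds (fun γ => Lf_ge σ ρ γ hσ hρ)
    (fun γ => Lf_le_one σ ρ γ hρ)
  exact Phi_tendsto.comp ((tendsto_atTop_add_const_right _ (-ρ) tendsto_id).atTop_div_const hσ)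

lemma exists_deriv_nonpos (f f' : ℝ → ℝ) (hf : ∀ x, 0 < x → HasDerivAt f (f' x) x) (a b : ℝ)
    (ha : 0 < a) (hab : a < b) (h : f b ≤ f a) : ∃ c ∈ Ioo a b, f' c ≤ 0 := by
  obtain ⟨c, hc, e⟩ := exists_hasDerivAt_eq_slope f f' hab
    (fun x hx => (hf x (lt_of_lt_of_le ha hx.1)).continuousAt.continuousWithinAt)
    (fun x hx => hf x (lt_trans ha hx.1))
  refine ⟨c, hc, ?_⟩
  rw [e]
  exact div_nonpos_of_nonpos_of_nonneg (by linarith) (by linarith)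

lemma exists_deriv_nonpos' (f f' : ℝ → ℝ) (hf : ∀ x, HasDerivAt f (f' x) x) (a b : ℝ)
    (hab : a < b) (h : f b ≤ f a) : ∃ c ∈ Ioo a b, f' c ≤ 0 := by
  obtain ⟨c, hc, e⟩ := exists_hasDerivAt_eq_slope f f' hab
    (fun x hx => (hf x).continuousAt.continuousWithinAt) (fun x hx => hf x)
  refine ⟨c, hc, ?_⟩
  rw [e]
  exact div_nonpos_of_nonpos_of_nonneg (by linarith) (by linarith)

lemma exists_deriv_nonpos_top (f f' : ℝ → ℝ) (hf : ∀ x, HasDerivAt f (f' x) x) (l a : ℝ)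
    (hl : Tendsto f atTop (𝓝 l)) (h : l ≤ f a) : ∃ c, a < c ∧ f' c ≤ 0 := by
  by_contra! hcon
  have hm : StrictMonoOn f (Ici a) := by
    refine strictMonoOn_of_deriv_pos (convex_Ici a)
      (fun x _ => (hf x).continuousAt.continuousWithinAt) fun x hx => ?_
    rw [interior_Ici] at hx
    rw [(hf x).deriv]; exact hcon x hx
  have h1 : f a < f (a + 1) := hm (by simp) (by simp) (by linarith)
  have h2 : f (a + 1) ≤ l := by
    refine ge_of_tendsto hl ?_
    filter_upwards [eventually_ge_atTop (a + 1)] with x hx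
    exact hm.monotoneOn (by simp) (by simp; linarith) hx
  linarith

lemma pos_of_deriv_pos (f f' : ℝ → ℝ) (hf : ∀ x, HasDerivAt f (f' x) x) (h0 : f 0 = 0)
    (h : ∀ x, 0 < x → 0 < f' x) : ∀ x, 0 < x → 0 < f x := by
  intro x hx
  by_contra! hc
  obtain ⟨c, hc, e⟩ := exists_deriv_nonpos' f f' hf 0 x hx (by linarith)
  have := h c hc.1
  linarith

lemma hyp_ineq : ∀ y : ℝ, 0 < y → 0 < y ^ 2 + y * Real.sinh y - 4 * Real.cosh y + 4 := by
  have hs := Real.hasDerivAt_sinh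
  have hc := Real.hasDerivAt_cosh
  have h4 : ∀ y : ℝ, 0 < y → 0 < y * Real.cosh y - Real.sinh y :=
    pos_of_deriv_pos _ (fun y => y * Real.sinh y)
      (fun y => by
        refine HasDerivAt.congr_deriv (((hasDerivAt_id y).mul (hc y)).sub (hs y)) ?_
        simp) (by simp) (fun y hy => mul_pos hy (Real.sinh_pos_iff.2 hy))
  have h3 : ∀ y : ℝ, 0 < y → 0 < 2 + y * Real.sinh y - 2 * Real.cosh y :=
    pos_of_deriv_pos _ (fun y => y * Real.cosh y - Real.sinh y)
      (fun y => by
        refine HasDerivAt.congr_deriv ((((hasDerivAt_id y).mul (hs y)).const_add 2).sub ((hc y).const_mul 2)) ?_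
        simp; ring) (by simp) h4
  have h2 : ∀ y : ℝ, 0 < y → 0 < 2 * y + y * Real.cosh y - 3 * Real.sinh y :=
    pos_of_deriv_pos _ (fun y => 2 + y * Real.sinh y - 2 * Real.cosh y)
      (fun y => by
        refine HasDerivAt.congr_deriv ((((hasDerivAt_id y).const_mul 2).add ((hasDerivAt_id y).mul (hc y))).sub
          ((hs y).const_mul 3)) ?_
        simp; ring) (by simp) h3
  exact pos_of_deriv_pos _ (fun y => 2 * y + y * Real.cosh y - 3 * Real.sinh y)
      (fun y => by
        refine HasDerivAt.congr_deriv (((((hasDerivAt_id y).pow 2).add ((hasDerivAt_id y).mul (hs y))).sub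
          ((hc y).const_mul 4)).add_const 4) ?_
        simp; ring) (by simp) h2

lemma hyp_ineq2 (x : ℝ) (hx : 0 < x) :
    0 < x ^ 2 + x * Real.sinh x * Real.cosh x - 2 * Real.sinh x ^ 2 := by
  have h := hyp_ineq (2 * x) (by linarith)
  rw [Real.sinh_two_mul, Real.cosh_two_mul] at h
  have := Real.cosh_sq x
  nlinarith

/-- The negative of the function (x coth x - 1) / x² -/
def psi (x : ℝ) : ℝ := 1 / x ^ 2 - Real.cosh x / (x * Real.sinh x)

lemma psi_mono : StrictMonoOn psi (Ioi 0) := by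
  have hd : ∀ x : ℝ, 0 < x → HasDerivAt psi
      (-2 / x ^ 3 - (Real.sinh x * (x * Real.sinh x) - Real.cosh x * (Real.sinh x + x * Real.cosh x))
        / (x * Real.sinh x) ^ 2) x := by
    intro x hx
    have hsx := Real.sinh_pos_iff.2 hx
    have a1 : HasDerivAt (fun x : ℝ => 1 / x ^ 2) (-2 / x ^ 3) x := by
      have h := ((hasDerivAt_id x).pow 2).inv (by simp; exact hx.ne')
      have h2 := h.congr_deriv (g' := -2 / x ^ 3) (by simp; field_simp)
      refine h2.congr_of_eventuallyEq (Eventually.of_forall fun y => ?_)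
      simp
    have a2 : HasDerivAt (fun x : ℝ => x * Real.sinh x) (Real.sinh x + x * Real.cosh x) x := by
      refine HasDerivAt.congr_deriv ((hasDerivAt_id x).mul (Real.hasDerivAt_sinh x)) ?_
      simp
    exact a1.sub ((Real.hasDerivAt_cosh x).div a2 (by positivity))
  refine strictMonoOn_of_deriv_pos (convex_Ioi 0)
    (fun x hx => (hd x hx).continuousAt.continuousWithinAt) fun x hx => ?_
  rw [interior_Ioi] at hx
  have hx : 0 < x := hx
  have hsx := Real.sinh_pos_iff.2 hx
  have hq := hyp_ineq2 x hx
  have hcs := Real.cosh_sq x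
  rw [(hd x hx).deriv]
  have : (-2 / x ^ 3 - (Real.sinh x * (x * Real.sinh x) -
      Real.cosh x * (Real.sinh x + x * Real.cosh x)) / (x * Real.sinh x) ^ 2)
      = (x ^ 2 + x * Real.sinh x * Real.cosh x - 2 * Real.sinh x ^ 2)
        / (x ^ 3 * Real.sinh x ^ 2) := by
    field_simp
    linear_combination x ^ 2 * hcs
  rw [this]
  positivity

lemma phi_hasDerivAt (x : ℝ) : HasDerivAt phi (-x * phi x) x := by
  have h : HasDerivAt (fun x : ℝ => -(x ^ 2) / 2) (-x) x := by
    refine HasDerivAt.congr_deriv (((hasDerivAt_id x).pow 2).neg.div_const 2) ?_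
    simp; ring
  refine HasDerivAt.congr_deriv ((h.exp).div_const (Real.sqrt (2 * Real.pi))) ?_
  unfold phi; ring

lemma phi_diff (σ ρ γ : ℝ) (hσ : 0 < σ) :
    phi ((γ - ρ) / σ) - phi ((γ + ρ) / σ)
      = Real.exp (-(γ ^ 2 + ρ ^ 2) / (2 * σ ^ 2)) * (2 * Real.sinh (γ * ρ / σ ^ 2))
        / Real.sqrt (2 * Real.pi) := by
  rw [phi, phi, Real.sinh_eq]
  have e1 : -((γ - ρ) / σ) ^ 2 / 2 = -(γ ^ 2 + ρ ^ 2) / (2 * σ ^ 2) + γ * ρ / σ ^ 2 := by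
    field_simp; ring
  have e2 : -((γ + ρ) / σ) ^ 2 / 2 = -(γ ^ 2 + ρ ^ 2) / (2 * σ ^ 2) + -(γ * ρ / σ ^ 2) := by
    field_simp; ring
  rw [e1, e2, Real.exp_add, Real.exp_add]
  ring

/-- log-ratio governing the sign of the derivative of the density difference -/
def Tf (σ τ ρ γ : ℝ) : ℝ :=
  Real.log γ - 3 * Real.log τ - γ ^ 2 / (2 * τ ^ 2) + Real.log (ρ * σ)
    + (γ ^ 2 + ρ ^ 2) / (2 * σ ^ 2) - Real.log (Real.sinh (γ * ρ / σ ^ 2))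

def gp (σ τ ρ γ : ℝ) : ℝ :=
  (1 / (2 * ρ)) * (phi ((γ + ρ) / σ) / σ - phi ((γ - ρ) / σ) / σ) + γ / τ ^ 3 * phi (γ / τ)

lemma gp_eq (σ τ ρ γ : ℝ) (hσ : 0 < σ) (hτ : 0 < τ) (hρ : 0 < ρ) (hγ : 0 < γ) :
    gp σ τ ρ γ = Real.exp (-(γ ^ 2 + ρ ^ 2) / (2 * σ ^ 2)) * Real.sinh (γ * ρ / σ ^ 2)
      / (Real.sqrt (2 * Real.pi) * (ρ * σ)) * (Real.exp (Tf σ τ ρ γ) - 1) := by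
  have hs : 0 < Real.sinh (γ * ρ / σ ^ 2) := Real.sinh_pos_iff.2 (by positivity)
  have h1 : gp σ τ ρ γ = γ / τ ^ 3 * phi (γ / τ)
      - (1 / (2 * ρ * σ)) * (phi ((γ - ρ) / σ) - phi ((γ + ρ) / σ)) := by
    unfold gp; field_simp; ring
  have h2 : Real.exp (Tf σ τ ρ γ) = γ / τ ^ 3 * Real.exp (-(γ / τ) ^ 2 / 2) * (ρ * σ)
      / Real.exp (-(γ ^ 2 + ρ ^ 2) / (2 * σ ^ 2)) / Real.sinh (γ * ρ / σ ^ 2) := by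
    have : Tf σ τ ρ γ = Real.log γ - Real.log (τ ^ 3) + (-(γ / τ) ^ 2 / 2) + Real.log (ρ * σ)
      - (-(γ ^ 2 + ρ ^ 2) / (2 * σ ^ 2)) - Real.log (Real.sinh (γ * ρ / σ ^ 2)) := by
      rw [Real.log_pow]; unfold Tf; push_cast; field_simp; ring
    rw [this, Real.exp_sub, Real.exp_sub, Real.exp_add, Real.exp_add, Real.exp_sub,
      Real.exp_log hγ, Real.exp_log (by positivity), Real.exp_log (by positivity), Real.exp_log hs]
  have he := Real.exp_pos (-(γ ^ 2 + ρ ^ 2) / (2 * σ ^ 2))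
  rw [h1, phi_diff σ ρ γ hσ, h2, phi]
  have hp : 0 < Real.sqrt (2 * Real.pi) := by positivity
  generalize Real.exp (-(γ ^ 2 + ρ ^ 2) / (2 * σ ^ 2)) = A at *
  generalize Real.exp (-(γ / τ) ^ 2 / 2) = B at *
  generalize Real.sinh (γ * ρ / σ ^ 2) = S at *
  field_simp

lemma Tf_hasDerivAt (σ τ ρ γ : ℝ) (hσ : 0 < σ) (hτ : 0 < τ) (hρ : 0 < ρ) (hγ : 0 < γ) :
    HasDerivAt (Tf σ τ ρ)
      (γ * (1 / σ ^ 2 - 1 / τ ^ 2 + (ρ / σ ^ 2) ^ 2 * psi (γ * ρ / σ ^ 2))) γ := by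
  have hs : 0 < Real.sinh (γ * ρ / σ ^ 2) := Real.sinh_pos_iff.2 (by positivity)
  have d1 := (Real.hasDerivAt_log hγ.ne').sub_const (3 * Real.log τ)
  have d2 : HasDerivAt (fun γ : ℝ => γ ^ 2 / (2 * τ ^ 2)) (2 * γ / (2 * τ ^ 2)) γ := by
    refine HasDerivAt.congr_deriv (((hasDerivAt_id γ).pow 2).div_const (2 * τ ^ 2)) ?_
    simp
  have d3 : HasDerivAt (fun γ : ℝ => (γ ^ 2 + ρ ^ 2) / (2 * σ ^ 2)) (2 * γ / (2 * σ ^ 2)) γ := by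
    refine HasDerivAt.congr_deriv ((((hasDerivAt_id γ).pow 2).add_const (ρ ^ 2)).div_const (2 * σ ^ 2)) ?_
    simp
  have d4 : HasDerivAt (fun γ : ℝ => γ * ρ / σ ^ 2) (ρ / σ ^ 2) γ := by
    refine HasDerivAt.congr_deriv (((hasDerivAt_id γ).mul_const ρ).div_const (σ ^ 2)) ?_
    simp
  have d5 := (d4.sinh).log hs.ne'
  refine HasDerivAt.congr_deriv ((((d1.sub d2).add_const (Real.log (ρ * σ))).add d3).sub d5) ?_
  unfold psi
  generalize Real.sinh (γ * ρ / σ ^ 2) = S at *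
  generalize Real.cosh (γ * ρ / σ ^ 2) = C at *
  field_simp
  ring

/-- the core comparison -/
lemma core (σ τ ρ : ℝ) (hσ : 0 < σ) (hτ : 0 < τ) (hρ : 0 < ρ)
    (h0 : (1 / (2 * ρ)) * (Phi (ρ / σ) - Phi (-ρ / σ)) = phi 0 / τ) (γ : ℝ) (hγ : 0 < γ) :
    Phi (γ / τ) < Lf σ ρ γ := by
  let G : ℝ → ℝ := fun x => Lf σ ρ x - Phi (x / τ)
  let g : ℝ → ℝ := fun x => (1 / (2 * ρ)) * (Phi ((x + ρ) / σ) - Phi ((x - ρ) / σ))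
    - phi (x / τ) / τ
  have ddiv : ∀ a s x : ℝ, HasDerivAt (fun x : ℝ => (x + a) / s) (1 / s) x := fun a s x =>
    ((hasDerivAt_id x).add_const a).div_const s
  have ddiv0 : ∀ s x : ℝ, HasDerivAt (fun x : ℝ => x / s) (1 / s) x := fun s x =>
    (hasDerivAt_id x).div_const s
  have dPhi : ∀ x : ℝ, HasDerivAt (fun x => Phi (x / τ)) (phi (x / τ) * (1 / τ)) x := fun x =>
    HasDerivAt.comp (h₂ := Phi) x (Phi_hasDerivAt (x / τ)) (ddiv0 τ x)
  have dphi : ∀ x : ℝ, HasDerivAt (fun x => phi (x / τ))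
      (-(x / τ) * phi (x / τ) * (1 / τ)) x := fun x =>
    HasDerivAt.comp (h₂ := phi) x (phi_hasDerivAt (x / τ)) (ddiv0 τ x)
  have hG : ∀ x, HasDerivAt G (g x) x := fun x => by
    refine HasDerivAt.congr_deriv ((Lf_hasDerivAt σ ρ x).sub (dPhi x)) ?_
    simp only [g]; ring
  have hg : ∀ x, HasDerivAt g (gp σ τ ρ x) x := fun x => by
    refine HasDerivAt.congr_deriv (((((Phi_hasDerivAt ((x + ρ) / σ)).comp x (ddiv ρ σ x)).sub
      ((Phi_hasDerivAt ((x + -ρ) / σ)).comp x (ddiv (-ρ) σ x))).const_mul (1 / (2 * ρ))).sub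
      ((dphi x).div_const τ)) ?_
    simp only [gp, ← sub_eq_add_neg]; field_simp; ring
  have hG0 : G 0 = 0 := by
    have := Lf_neg σ ρ 0 hρ
    rw [neg_zero] at this
    simp only [G, zero_div, Phi_zero]; linarith
  have hg0 : g 0 = 0 := by
    simp only [g, zero_add, zero_sub, zero_div]; linarith
  have tdiv : ∀ a s : ℝ, 0 < s → Tendsto (fun x : ℝ => (x + a) / s) atTop atTop := fun a s hs =>
    (tendsto_atTop_add_const_right _ a tendsto_id).atTop_div_const hs
  have hGt : Tendsto G atTop (𝓝 0) := by
    have := (Lf_tendsto σ ρ hσ hρ).sub (Phi_tendsto.comp (tdiv 0 τ hτ))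
    simpa [G, Function.comp_def] using this
  have hphit : Tendsto phi atTop (𝓝 0) := by
    have h1 : Tendsto (fun x : ℝ => -(x ^ 2) / 2) atTop atBot := by
      have := (tendsto_pow_atTop (α := ℝ) (n := 2) (by norm_num)).atTop_div_const (r := 2) (by norm_num)
      have := tendsto_neg_atTop_atBot.comp this
      refine this.congr fun x => ?_
      simp; ring
    have := (Real.tendsto_exp_atBot.comp h1).div_const (Real.sqrt (2 * Real.pi))
    rw [zero_div] at this
    exact this
  have hgt : Tendsto g atTop (𝓝 0) := by
    have := (((Phi_tendsto.comp (tdiv ρ σ hσ)).sub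
      (Phi_tendsto.comp (tdiv (-ρ) σ hσ))).const_mul (1 / (2 * ρ))).sub
      ((hphit.comp (tdiv 0 τ hτ)).div_const τ)
    simpa [g, Function.comp_def, sub_eq_add_neg] using this
  by_contra! hcon
  have hGγ : G γ ≤ 0 := by simp only [G]; linarith
  obtain ⟨x1, hx1, hgx1⟩ := exists_deriv_nonpos' G g hG 0 γ hγ (by linarith)
  obtain ⟨x2, hx2, hgx2⟩ := exists_deriv_nonpos_top (fun x => - G x) (fun x => - g x)
    (fun x => (hG x).neg) 0 γ (by simpa using hGt.neg) (by linarith)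
  obtain ⟨y1, hy1, h1⟩ := exists_deriv_nonpos' g _ hg 0 x1 hx1.1 (by linarith)
  obtain ⟨y2, hy2, h2⟩ := exists_deriv_nonpos' (fun x => - g x) (fun x => - gp σ τ ρ x)
    (fun x => (hg x).neg) x1 x2 (by linarith [hx1.2]) (by linarith)
  obtain ⟨y3, hy3, h3⟩ := exists_deriv_nonpos_top g _ hg 0 x2 hgt (by linarith)
  have hy1p := hy1.1
  have hy12 : y1 < y2 := hy1.2.trans hy2.1
  have hy23 : y2 < y3 := hy2.2.trans hy3
  have key : ∀ y, 0 < y → (gp σ τ ρ y ≤ 0 ↔ Tf σ τ ρ y ≤ 0) ∧ (0 ≤ gp σ τ ρ y ↔ 0 ≤ Tf σ τ ρ y) := by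
    intro y hy
    have hs : 0 < Real.sinh (y * ρ / σ ^ 2) := Real.sinh_pos_iff.2 (by positivity)
    rw [gp_eq σ τ ρ y hσ hτ hρ hy]
    have hc : 0 < Real.exp (-(y ^ 2 + ρ ^ 2) / (2 * σ ^ 2)) * Real.sinh (y * ρ / σ ^ 2)
      / (Real.sqrt (2 * Real.pi) * (ρ * σ)) := by positivity
    rw [mul_nonneg_iff_of_pos_left hc, sub_nonneg, Real.one_le_exp_iff]
    refine ⟨?_, Iff.rfl⟩
    rw [← not_lt, mul_pos_iff_of_pos_left hc, not_lt, sub_nonpos, Real.exp_le_one_iff]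
  have t1 := (key y1 hy1p).1.1 h1
  have t2 := (key y2 (by linarith)).2.1 (by linarith)
  have t3 := (key y3 (by linarith)).1.1 h3
  have hT := fun x (hx : 0 < x) => Tf_hasDerivAt σ τ ρ x hσ hτ hρ hx
  obtain ⟨z2, hz2, k2⟩ := exists_deriv_nonpos (fun x => - Tf σ τ ρ x) (fun γ => -
    (γ * (1 / σ ^ 2 - 1 / τ ^ 2 + (ρ / σ ^ 2) ^ 2 * psi (γ * ρ / σ ^ 2))))
    (fun x hx => (hT x hx).neg) y1 y2 hy1p hy12 (by linarith)
  obtain ⟨z3, hz3, k3⟩ := exists_deriv_nonpos _ _ hT y2 y3 (by linarith) hy23 (by linarith)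
  have hz2p : 0 < z2 := hy1p.trans hz2.1
  have hz23 : z2 < z3 := hz2.2.trans hz3.1
  have hz3p : 0 < z3 := hz2p.trans hz23
  have hpsi : psi (z2 * ρ / σ ^ 2) < psi (z3 * ρ / σ ^ 2) :=
    psi_mono (show 0 < z2 * ρ / σ ^ 2 by positivity) (show 0 < z3 * ρ / σ ^ 2 by positivity)
      (by gcongr)
  have hr : 0 < (ρ / σ ^ 2) ^ 2 := by positivity
  have m1 := nonneg_of_mul_nonneg_right (neg_nonpos.1 k2) hz2p
  have m2 := nonpos_of_mul_nonpos_right k3 hz3p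
  have := mul_lt_mul_of_pos_left hpsi hr
  linarith

lemma Lf_le (σ ρ k : ℝ) (hσ : 0 < σ) (hρ : 0 < ρ)
    (h0 : (1 / (2 * ρ)) * (Phi (ρ / σ) - Phi (-ρ / σ)) = 1 / (2 * k)) (γ : ℝ) (hγ : 0 ≤ γ) :
    Lf σ ρ γ ≤ 1 / 2 + γ / (2 * k) := by
  have ddiv : ∀ a s x : ℝ, HasDerivAt (fun x : ℝ => (x + a) / s) (1 / s) x := fun a s x =>
    ((hasDerivAt_id x).add_const a).div_const s
  let g : ℝ → ℝ := fun x => (1 / (2 * ρ)) * (Phi ((x + ρ) / σ) - Phi ((x - ρ) / σ))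
  have hg : ∀ x, HasDerivAt g (1 / (2 * ρ) * ((phi ((x + ρ) / σ) - phi ((x - ρ) / σ)) / σ)) x :=
      fun x => by
    refine HasDerivAt.congr_deriv (((((Phi_hasDerivAt ((x + ρ) / σ)).comp x (ddiv ρ σ x)).sub
      ((Phi_hasDerivAt ((x + -ρ) / σ)).comp x (ddiv (-ρ) σ x))).const_mul (1 / (2 * ρ)))) ?_
    simp only [← sub_eq_add_neg]; field_simp
  have hga : AntitoneOn g (Ici 0) := by
    refine antitoneOn_of_deriv_nonpos (convex_Ici 0)
      (fun x _ => (hg x).continuousAt.continuousWithinAt)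
      (fun x _ => (hg x).differentiableAt.differentiableWithinAt) fun x hx => ?_
    rw [interior_Ici] at hx
    have hx : 0 < x := hx
    have hs : 0 < Real.sinh (x * ρ / σ ^ 2) := Real.sinh_pos_iff.2 (by positivity)
    have := phi_diff σ ρ x hσ
    have hp : 0 < phi ((x - ρ) / σ) - phi ((x + ρ) / σ) := by rw [this]; positivity
    rw [(hg x).deriv]
    refine mul_nonpos_of_nonneg_of_nonpos (by positivity) ?_
    exact div_nonpos_of_nonpos_of_nonneg (by linarith) hσ.le
  let D : ℝ → ℝ := fun x => Lf σ ρ x - x / (2 * k)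
  have hD : ∀ x, HasDerivAt D (g x - 1 / (2 * k)) x := fun x =>
    (Lf_hasDerivAt σ ρ x).sub ((hasDerivAt_id x).div_const (2 * k))
  have hDa : AntitoneOn D (Ici 0) := by
    refine antitoneOn_of_deriv_nonpos (convex_Ici 0)
      (fun x _ => (hD x).continuousAt.continuousWithinAt)
      (fun x _ => (hD x).differentiableAt.differentiableWithinAt) fun x hx => ?_
    rw [interior_Ici] at hx
    have hx : 0 < x := hx
    rw [(hD x).deriv]
    have h1 := hga (show (0 : ℝ) ∈ Ici 0 by simp) (show x ∈ Ici 0 from hx.le) hx.le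
    have h2 : g 0 = 1 / (2 * k) := by rw [← h0]; simp only [g, zero_add, zero_sub]
    linarith
  have h1 := hDa (show (0 : ℝ) ∈ Ici 0 by simp) (show γ ∈ Ici 0 from hγ) hγ
  have := Lf_neg σ ρ 0 hρ
  rw [neg_zero] at this
  simp only [D, zero_div] at h1
  linarith

lemma Rbar_ge (σ k : ℝ) (hk : 0 < k) (d : ℝ → ℝ) (γ u : ℝ) (hu : u ∈ Icc (γ - k) (γ + k))
    (h0 : 0 ≤ Eg σ γ d) (h1 : Eg σ γ d ≤ 1) :
    u * ((if 0 ≤ u then (1 : ℝ) else 0) - Eg σ γ d) ≤ Rbar σ k d γ := by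
  refine le_csSup ⟨|γ| + k, ?_⟩ ⟨u, hu, rfl⟩
  rintro _ ⟨v, hv, rfl⟩
  have a1 := le_abs_self γ
  have a2 := neg_abs_le γ
  obtain ⟨b1, b2⟩ := hv
  simp only
  split_ifs with h <;> nlinarith

lemma Rbar_le (σ k : ℝ) (hk : 0 < k) (d : ℝ → ℝ) (γ M : ℝ)
    (h0 : 0 ≤ Eg σ γ d) (h1 : Eg σ γ d ≤ 1) (hM1 : (γ + k) * (1 - Eg σ γ d) ≤ M)
    (hM2 : (k - γ) * Eg σ γ d ≤ M) : Rbar σ k d γ ≤ M := by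
  refine csSup_le ⟨_, γ, ⟨by linarith, by linarith⟩, rfl⟩ ?_
  rintro _ ⟨v, hv, rfl⟩
  obtain ⟨b1, b2⟩ := hv
  simp only
  split_ifs with h <;> nlinarith

/-- **Proposition (profiled-regret dominance, part (i)).** In the scalar setting with
`k > √(π/2)·σ`, if `φ(ρ*/σ)·(k/(√(π/2)·σ))³ ≤ φ(0)`, then the piecewise linear rule has
weakly smaller profiled regret than `d_RT` everywhere, strictly for `γ ≠ 0`. -/
theorem dlinear_profiled_regret_dominates_dRT
    (σ k : ℝ) (hσ : 0 < σ) (hk : Real.sqrt (Real.pi / 2) * σ < k)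
    (ρ : ℝ) (hρmem : ρ ∈ Set.Ioo 0 k)
    (hρeq : ρ / (2 * k) - 1 / 2 + Phi (-ρ / σ) = 0)
    (hcond : phi (ρ / σ) * (k / (Real.sqrt (Real.pi / 2) * σ)) ^ 3 ≤ phi 0) :
    ∀ γ : ℝ, Rbar σ k (dlin ρ) γ ≤ Rbar σ k (dRT σ k) γ ∧
      (γ ≠ 0 → Rbar σ k (dlin ρ) γ < Rbar σ k (dRT σ k) γ) := by
  obtain ⟨hρ, hρk⟩ := hρmem
  have hk0 : 0 < k := hρ.trans hρk
  have hq : 0 < Real.sqrt (Real.pi / 2) := Real.sqrt_pos.2 (by positivity)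
  have hτ : 0 < k / Real.sqrt (Real.pi / 2) := by positivity
  have hsl : (1 / (2 * ρ)) * (Phi (ρ / σ) - Phi (-ρ / σ)) = 1 / (2 * k) := by
    have h1 : Phi (ρ / σ) = 1 - Phi (-ρ / σ) := by
      rw [neg_div, Phi_neg]; ring
    have h2 : Phi (-ρ / σ) = 1 / 2 - ρ / (2 * k) := by linarith
    rw [h1, h2]; field_simp; ring
  have hsl2 : 1 / (2 * k) = phi 0 / (k / Real.sqrt (Real.pi / 2)) := by
    have h4 : Real.sqrt (2 * Real.pi) = 2 * Real.sqrt (Real.pi / 2) := by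
      rw [show 2 * Real.pi = 2 ^ 2 * (Real.pi / 2) by ring, Real.sqrt_mul (by positivity),
        Real.sqrt_sq (by norm_num)]
    simp only [phi, h4]
    simp
    field_simp
  have hcore := core σ _ ρ hσ hτ hρ (hsl.trans hsl2)
  have hle := Lf_le σ ρ k hσ hρ hsl
  have hneg := fun γ => Lf_neg σ ρ γ hρ
  have hL : ∀ γ, Eg σ γ (dlin ρ) = Lf σ ρ γ := fun γ => Eg_dlin σ ρ γ hσ hρ
  have hP := fun γ => Eg_dRT σ k γ hσ hk
  have hL1 : ∀ γ, Lf σ ρ γ ≤ 1 := fun γ => Lf_le_one σ ρ γ hρ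
  have hL0 : ∀ γ, 0 ≤ Lf σ ρ γ := fun γ => (Phi_nonneg _).trans (Lf_ge σ ρ γ hσ hρ)
  set τ := k / Real.sqrt (Real.pi / 2) with hτdef
  -- profiled regret of the linear rule for nonnegative γ
  have up : ∀ γ, 0 ≤ γ → Rbar σ k (dlin ρ) γ ≤ (γ + k) * (1 - Lf σ ρ γ) := by
    intro γ hγ
    have h := hle γ hγ
    have h' : 2 * k * Lf σ ρ γ ≤ k + γ := by
      have := mul_le_mul_of_nonneg_left h (by positivity : 0 ≤ 2 * k)
      rw [mul_add, mul_div_cancel₀ _ (by positivity : 2 * k ≠ 0)] at this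
      linarith
    refine Rbar_le σ k hk0 _ γ _ ?_ ?_ ?_ ?_ <;> rw [hL]
    · exact hL0 γ
    · exact hL1 γ
    · linarith
  have un : ∀ γ, 0 ≤ γ → Rbar σ k (dlin ρ) (-γ) ≤ (γ + k) * (1 - Lf σ ρ γ) := by
    intro γ hγ
    have h := hle γ hγ
    have h' : 2 * k * Lf σ ρ γ ≤ k + γ := by
      have := mul_le_mul_of_nonneg_left h (by positivity : 0 ≤ 2 * k)
      rw [mul_add, mul_div_cancel₀ _ (by positivity : 2 * k ≠ 0)] at this
      linarith
    refine Rbar_le σ k hk0 _ (-γ) _ ?_ ?_ ?_ ?_ <;> rw [hL]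
    · exact hL0 _
    · exact hL1 _
    · rw [hneg]; linarith
    · rw [hneg]; linarith
  have lp : ∀ γ, 0 ≤ γ → (γ + k) * (1 - Phi (γ / τ)) ≤ Rbar σ k (dRT σ k) γ := by
    intro γ hγ
    have := Rbar_ge σ k hk0 (dRT σ k) γ (γ + k) ⟨by linarith, le_rfl⟩
      (by rw [hP]; exact Phi_nonneg _) (by rw [hP]; exact Phi_le_one _)
    rwa [if_pos (by linarith), hP] at this
  have ln : ∀ γ, 0 ≤ γ → (γ + k) * (1 - Phi (γ / τ)) ≤ Rbar σ k (dRT σ k) (-γ) := by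
    intro γ hγ
    have := Rbar_ge σ k hk0 (dRT σ k) (-γ) (-γ - k) ⟨le_rfl, by linarith⟩
      (by rw [hP]; exact Phi_nonneg _) (by rw [hP]; exact Phi_le_one _)
    rw [if_neg (by linarith), hP, neg_div, Phi_neg] at this
    linarith
  have hst : ∀ γ, γ ≠ 0 → Rbar σ k (dlin ρ) γ < Rbar σ k (dRT σ k) γ := by
    intro γ hγ
    rcases lt_or_gt_of_ne hγ with h | h
    · have hp : 0 < -γ := by linarith
      have a1 := un (-γ) hp.le
      have a2 := ln (-γ) hp.le
      rw [neg_neg] at a1 a2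
      have a3 := mul_lt_mul_of_pos_left (hcore (-γ) hp) (by linarith : 0 < -γ + k)
      linarith
    · have a1 := up γ h.le
      have a2 := lp γ h.le
      have a3 := mul_lt_mul_of_pos_left (hcore γ h) (by linarith : 0 < γ + k)
      linarith
  intro γ
  refine ⟨?_, hst γ⟩
  by_cases h : γ = 0
  · subst h
    have a1 := up 0 le_rfl
    have a2 := lp 0 le_rfl
    have a3 := hneg 0
    rw [neg_zero] at a3
    have a4 : Lf σ ρ 0 = 1 / 2 := by linarith
    rw [zero_div, Phi_zero] at a2
    rw [a4] at a1
    linarith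
  · exact (hst γ h).le
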